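/- For p ≥ 1 define γ_p = inf{∫_ℝ (|u'(t)|² + |t|^p |u(t)|²) dt : u ∈ C_c^∞(ℝ), ∫_ℝ |u(t)|² dt = 1}. Then the function p ↦ γ_p is continuous on [1, ∞) and γ_p > 0 for every p ≥ 1. -/

import Mathlib

open MeasureTheory

/-- `γ_p`: the ground-state energy of the one-dimensional (an)harmonic oscillator
`H_p : u ↦ -u'' + |t|^p u` on `L²(ℝ)`, defined variationally:
`γ_p = inf {∫_ℝ (|u'(t)|² + |t|^p |u(t)|²) dt : u ∈ C_c^∞(ℝ), ∫_ℝ |u|² = 1}`. -/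
noncomputable def gammaP (p : ℝ) : ℝ :=
  sInf { E : ℝ | ∃ u : ℝ → ℝ, ContDiff ℝ (⊤ : ℕ∞) u ∧ HasCompactSupport u ∧
    (∫ t : ℝ, (u t) ^ 2) = 1 ∧
    E = ∫ t : ℝ, ((deriv u t) ^ 2 + |t| ^ p * (u t) ^ 2) }

/-- The energy `∫ (|u'|² + |t|^p |u|²)` of a trial function. -/
noncomputable def oscEnergy (p : ℝ) (u : ℝ → ℝ) : ℝ :=
  ∫ t : ℝ, ((deriv u t) ^ 2 + |t| ^ p * (u t) ^ 2)

section TrialFunctions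

variable {u : ℝ → ℝ}

lemma continuous_deriv_of_contDiff_top (hu : ContDiff ℝ (⊤ : ℕ∞) u) : Continuous (deriv u) :=
  hu.continuous_deriv (by exact_mod_cast le_top)

lemma differentiable_of_contDiff_top (hu : ContDiff ℝ (⊤ : ℕ∞) u) : Differentiable ℝ u :=
  hu.differentiable (by simp)

lemma HasCompactSupport.pow_two (hc : HasCompactSupport u) :
    HasCompactSupport fun t => (u t) ^ 2 :=
  hc.comp_left (g := fun x : ℝ => x ^ 2) (by simp)

lemma integrable_sq (hu : ContDiff ℝ (⊤ : ℕ∞) u) (hc : HasCompactSupport u) :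
    Integrable fun t => (u t) ^ 2 :=
  (hu.continuous.pow 2).integrable_of_hasCompactSupport hc.pow_two

lemma integrable_oscEnergy {p : ℝ} (hp : 0 ≤ p) (hu : ContDiff ℝ (⊤ : ℕ∞) u)
    (hc : HasCompactSupport u) :
    Integrable fun t => (deriv u t) ^ 2 + |t| ^ p * (u t) ^ 2 := by
  refine Continuous.integrable_of_hasCompactSupport ?_ ?_
  · exact ((continuous_deriv_of_contDiff_top hu).pow 2).add
      ((continuous_abs.rpow_const fun _ => Or.inr hp).mul (hu.continuous.pow 2))
  · exact hc.deriv.pow_two.add hc.pow_two.mul_left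

lemma oscEnergy_nonneg (p : ℝ) (u : ℝ → ℝ) : 0 ≤ oscEnergy p u :=
  integral_nonneg fun _ => by positivity

lemma oscEnergy_const_mul (p c : ℝ) (hu : Differentiable ℝ u) :
    oscEnergy p (fun t => c * u t) = c ^ 2 * oscEnergy p u := by
  unfold oscEnergy
  rw [← integral_const_mul]
  refine integral_congr_ae (.of_forall fun t => ?_)
  simp only [deriv_const_mul c (hu t)]
  ring

end TrialFunctions

/-- The admissible energies, whose infimum is `gammaP p`. -/
def energySet (p : ℝ) : Set ℝ :=
  { E : ℝ | ∃ u : ℝ → ℝ, ContDiff ℝ (⊤ : ℕ∞) u ∧ HasCompactSupport u ∧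
    (∫ t : ℝ, (u t) ^ 2) = 1 ∧
    E = ∫ t : ℝ, ((deriv u t) ^ 2 + |t| ^ p * (u t) ^ 2) }

lemma gammaP_eq_sInf (p : ℝ) : gammaP p = sInf (energySet p) := rfl

lemma bddBelow_energySet (p : ℝ) : BddBelow (energySet p) :=
  ⟨0, by rintro E ⟨u, -, -, -, rfl⟩; exact oscEnergy_nonneg p u⟩

lemma oscEnergy_div_mem_energySet (p : ℝ) {v : ℝ → ℝ} (hv : ContDiff ℝ (⊤ : ℕ∞) v)
    (hc : HasCompactSupport v) (hpos : 0 < ∫ t : ℝ, (v t) ^ 2) :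
    oscEnergy p v / (∫ t : ℝ, (v t) ^ 2) ∈ energySet p := by
  set N := ∫ t : ℝ, (v t) ^ 2 with hN
  have hs : ((√N)⁻¹) ^ 2 = N⁻¹ := by rw [inv_pow, Real.sq_sqrt hpos.le]
  refine ⟨fun t => (√N)⁻¹ * v t, contDiff_const.mul hv, hc.mul_left, ?_, ?_⟩
  · simp only [mul_pow]
    rw [integral_const_mul, hs, ← hN, inv_mul_cancel₀ hpos.ne']
  · change _ = oscEnergy p _
    rw [oscEnergy_const_mul p _ (differentiable_of_contDiff_top hv), hs, div_eq_inv_mul]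

lemma gammaP_mul_le_oscEnergy (p : ℝ) {v : ℝ → ℝ} (hv : ContDiff ℝ (⊤ : ℕ∞) v)
    (hc : HasCompactSupport v) : gammaP p * (∫ t : ℝ, (v t) ^ 2) ≤ oscEnergy p v := by
  have h0 : 0 ≤ ∫ t : ℝ, (v t) ^ 2 := integral_nonneg fun _ => sq_nonneg _
  rcases h0.eq_or_lt with h | h
  · rw [← h, mul_zero]
    exact oscEnergy_nonneg p v
  · rw [← le_div_iff₀ h]
    exact csInf_le (bddBelow_energySet p) (oscEnergy_div_mem_energySet p hv hc h)

lemma energySet_nonempty (p : ℝ) : (energySet p).Nonempty := by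
  let f : ContDiffBump (0 : ℝ) := ⟨1, 2, one_pos, one_lt_two⟩
  refine ⟨_, oscEnergy_div_mem_energySet p (v := f) f.contDiff f.hasCompactSupport ?_⟩
  refine (f.continuous.pow 2).integral_pos_of_hasCompactSupport_nonneg_nonzero
    f.hasCompactSupport.pow_two (fun _ => sq_nonneg _) (x := 0) ?_
  have : f 0 = 1 := f.one_of_mem_closedBall (by simp [f])
  simp [this]

lemma gammaP_nonneg (p : ℝ) : 0 ≤ gammaP p :=
  Real.sInf_nonneg (by rintro E ⟨u, -, -, -, rfl⟩; exact oscEnergy_nonneg p u)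

lemma gammaP_mem_closure_energySet (p : ℝ) : gammaP p ∈ closure (energySet p) :=
  csInf_mem_closure (energySet_nonempty p) (bddBelow_energySet p)

lemma rpow_le_rpow_add_sub {x p q : ℝ} (hx : 0 ≤ x) (hp : 1 ≤ p) (hpq : p ≤ q) :
    x ^ p ≤ x ^ q + (q - p) := by
  rcases hx.eq_or_lt with rfl | hx
  · rw [Real.zero_rpow (by linarith), Real.zero_rpow (by linarith)]
    linarith
  rcases le_total 1 x with h1 | h1
  · have := Real.rpow_le_rpow_of_exponent_le h1 hpq
    linarith
  have hsplit : x ^ q = x ^ p * x ^ (q - p) := by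
    rw [← Real.rpow_add hx, add_sub_cancel]
  have hexp : 1 + (q - p) * Real.log x ≤ x ^ (q - p) := by
    rw [Real.rpow_def_of_pos hx]
    linarith [Real.add_one_le_exp (Real.log x * (q - p))]
  have hlog : x * -Real.log x ≤ 1 := by
    have h := Real.log_le_sub_one_of_pos (inv_pos.2 hx)
    rw [Real.log_inv] at h
    have h2 := mul_le_mul_of_nonneg_left h hx.le
    rw [mul_sub, mul_inv_cancel₀ hx.ne'] at h2
    linarith
  have hxp : x ^ p ≤ x := by
    simpa using Real.rpow_le_rpow_of_exponent_ge hx h1 hp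
  have hlog0 : 0 ≤ -Real.log x := by linarith [Real.log_nonpos hx.le h1]
  have hxp0 : 0 ≤ x ^ p := Real.rpow_nonneg hx.le p
  have h3 : x ^ p * -Real.log x ≤ 1 :=
    (mul_le_mul_of_nonneg_right hxp hlog0).trans hlog
  have h4 : x ^ p * (1 + (q - p) * Real.log x) ≤ x ^ q := by
    rw [hsplit]
    exact mul_le_mul_of_nonneg_left hexp hxp0
  nlinarith [mul_le_mul_of_nonneg_left h3 (sub_nonneg.2 hpq)]

lemma gammaP_le_add_sub {p q : ℝ} (hp : 1 ≤ p) (hpq : p ≤ q) :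
    gammaP p ≤ gammaP q + (q - p) := by
  rw [← sub_le_iff_le_add, gammaP_eq_sInf q]
  refine le_csInf (energySet_nonempty q) ?_
  rintro E ⟨u, hu, hc, h1, rfl⟩
  have hγ := gammaP_mul_le_oscEnergy p hu hc
  rw [h1, mul_one] at hγ
  have hq := integrable_oscEnergy (p := q) (by linarith) hu hc
  have hmono : oscEnergy p u ≤
      ∫ t, ((deriv u t) ^ 2 + |t| ^ q * (u t) ^ 2 + (q - p) * (u t) ^ 2) := by
    refine integral_mono (integrable_oscEnergy (by linarith) hu hc)
      (hq.add ((integrable_sq hu hc).const_mul _)) fun t => ?_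
    have := mul_le_mul_of_nonneg_right (rpow_le_rpow_add_sub (abs_nonneg t) hp hpq)
      (sq_nonneg (u t))
    dsimp only
    linarith
  rw [integral_add hq ((integrable_sq hu hc).const_mul _), integral_const_mul, h1] at hmono
  linarith

lemma gammaP_pos {p : ℝ} (hp : 1 ≤ p) : 0 < gammaP p := by
  suffices h : (1 / 16 : ℝ) ≤ gammaP p by linarith
  refine le_csInf (energySet_nonempty p) ?_
  rintro E ⟨u, hu, hc, h1, rfl⟩
  have hd := differentiable_of_contDiff_top hu
  have hderiv (t : ℝ) : HasDerivAt (fun t => 1 / 4 * Real.arctan t * (u t) ^ 2)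
      (1 / 4 * (1 / (1 + t ^ 2)) * (u t) ^ 2 +
        1 / 4 * Real.arctan t * (2 * u t * deriv u t)) t := by
    have h2 : HasDerivAt (fun t => (u t) ^ 2) (2 * u t * deriv u t) t := by
      simpa using (hd t).hasDerivAt.fun_pow 2
    exact ((Real.hasDerivAt_arctan t).const_mul _).mul h2
  have hgint' : Integrable fun t => 1 / 4 * (1 / (1 + t ^ 2)) * (u t) ^ 2 +
      1 / 4 * Real.arctan t * (2 * u t * deriv u t) := by
    refine Continuous.integrable_of_hasCompactSupport ?_ ?_
    · have h3 := continuous_deriv_of_contDiff_top hu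
      have h4 := hu.continuous
      have h5 : Continuous fun t : ℝ => 1 / (1 + t ^ 2) :=
        continuous_const.div (by fun_prop) fun t => by positivity
      have h6 := Real.continuous_arctan
      fun_prop
    · exact hc.pow_two.mul_left.add (hc.mul_left.mul_right.mul_left)
  have hgint : Integrable fun t => 1 / 4 * Real.arctan t * (u t) ^ 2 :=
    Continuous.integrable_of_hasCompactSupport
      ((continuous_const.mul Real.continuous_arctan).mul (hu.continuous.pow 2))
      hc.pow_two.mul_left
  have hzero := integral_eq_zero_of_hasDerivAt_of_integrable hderiv hgint' hgint
  have hE := integrable_oscEnergy (p := p) (by linarith) hu hc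
  have hmono : ∫ t, 1 / 16 * (u t) ^ 2 ≤
      ∫ t, ((deriv u t) ^ 2 + |t| ^ p * (u t) ^ 2 +
        (1 / 4 * (1 / (1 + t ^ 2)) * (u t) ^ 2 +
        1 / 4 * Real.arctan t * (2 * u t * deriv u t))) := by
    refine integral_mono ((integrable_sq hu hc).const_mul _)
      (hE.add hgint') fun t => ?_
    have key : 1 / 16 ≤ |t| ^ p + 1 / 4 * (1 / (1 + t ^ 2)) - (1 / 4 * Real.arctan t) ^ 2 := by
      rcases le_total 1 |t| with h | h
      · have h2 : 1 ≤ |t| ^ p := Real.one_le_rpow h (by linarith)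
        have h3 : 0 ≤ 1 / (1 + t ^ 2) := by positivity
        have h4 := Real.arctan_lt_pi_div_two t
        have h5 := Real.neg_pi_div_two_lt_arctan t
        have h6 := Real.pi_le_four
        have h7 : (Real.arctan t) ^ 2 ≤ 2 ^ 2 := sq_le_sq' (by linarith) (by linarith)
        nlinarith
      · have h2 : 0 ≤ |t| ^ p := by positivity
        have ht : t ^ 2 ≤ 1 := by rwa [sq_le_one_iff_abs_le_one]
        have h3 : 1 / 2 ≤ 1 / (1 + t ^ 2) :=
          one_div_le_one_div_of_le (by positivity) (by linarith)
        have h4 : (Real.arctan t) ^ 2 ≤ 1 ^ 2 := by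
          have := abs_le.1 h
          refine sq_le_sq' ?_ ?_
          · have h8 := Real.arctan_strictMono.monotone this.1
            rw [Real.arctan_neg, Real.arctan_one] at h8
            linarith [Real.pi_le_four]
          · have h8 := Real.arctan_strictMono.monotone this.2
            rw [Real.arctan_one] at h8
            linarith [Real.pi_le_four]
        nlinarith
    have h7 := mul_le_mul_of_nonneg_right key (sq_nonneg (u t))
    dsimp only
    nlinarith [sq_nonneg (deriv u t + 1 / 4 * Real.arctan t * u t)]
  rw [integral_add hE hgint', integral_const_mul, hzero, h1] at hmono
  linarith

/-- A smooth plateau function equal to `1` on `[-1, 1]` and `0` outside `(-2, 2)`. -/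
lemma exists_smooth_cutoff : ∃ (χ : ℝ → ℝ) (K : ℝ), ContDiff ℝ (⊤ : ℕ∞) χ ∧
    (∀ t, 0 ≤ χ t ∧ χ t ≤ 1) ∧ (∀ t, |t| ≤ 1 → χ t = 1) ∧ (∀ t, 2 ≤ |t| → χ t = 0) ∧
    ∀ t, (deriv χ t) ^ 2 ≤ K := by
  let f : ContDiffBump (0 : ℝ) := ⟨1, 2, one_pos, one_lt_two⟩
  have hf : ContDiff ℝ (⊤ : ℕ∞) f := f.contDiff
  obtain ⟨K, hK⟩ := (continuous_deriv_of_contDiff_top hf).bounded_above_of_compact_support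
    f.hasCompactSupport.deriv
  refine ⟨f, K ^ 2, hf, fun t => ⟨f.nonneg, f.le_one⟩, fun t ht => ?_, fun t ht => ?_, fun t => ?_⟩
  · exact f.one_of_mem_closedBall (by simpa [f] using ht)
  · exact f.zero_of_le_dist (by simpa [f] using ht)
  · rw [← sq_abs]
    exact pow_le_pow_left₀ (abs_nonneg _) (hK t) 2

/-- Comparison of trial energies at exponents `p ≤ q` by truncating at scale `R`. -/
lemma exists_gammaP_truncation_bound : ∃ K : ℝ, 0 ≤ K ∧ ∀ p q R : ℝ, 1 ≤ p → p ≤ q → 1 ≤ R →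
    gammaP q * (1 - gammaP p / R) ≤ (2 * R) ^ (q - p) * (1 + 1 / R) * gammaP p + K / R := by
  obtain ⟨χ, K, hχ, h01, hone, hzero, hK⟩ := exists_smooth_cutoff
  have hK0 : 0 ≤ K := (sq_nonneg _).trans (hK 0)
  refine ⟨2 * K, by positivity, fun p q R hp hpq hR => ?_⟩
  have hR0 : 0 < R := by linarith
  have hclosed : IsClosed {E : ℝ | gammaP q * (1 - E / R) ≤
      (2 * R) ^ (q - p) * (1 + 1 / R) * E + 2 * K / R} :=
    isClosed_le (by fun_prop) (by fun_prop)
  refine closure_minimal ?_ hclosed (gammaP_mem_closure_energySet p)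
  rintro E ⟨u, hu, hc, h1, rfl⟩
  rw [Set.mem_ofPred_eq]
  set A := (2 * R) ^ (q - p) with hA
  have hA1 : 1 ≤ A := Real.one_le_rpow (by linarith) (by linarith)
  have hscale : ContDiff ℝ (⊤ : ℕ∞) fun t => χ (t / R) := hχ.comp (contDiff_id.div_const R)
  have hw : ContDiff ℝ (⊤ : ℕ∞) fun t => χ (t / R) * u t := hscale.mul hu
  have hwc : HasCompactSupport fun t => χ (t / R) * u t := hc.mul_left
  have hwd (t : ℝ) : deriv (fun t => χ (t / R) * u t) t =
      deriv χ (t / R) / R * u t + χ (t / R) * deriv u t := by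
    have h2 : HasDerivAt (fun t => χ (t / R)) (deriv χ (t / R) * (1 / R)) t :=
      (differentiable_of_contDiff_top hχ (t / R)).hasDerivAt.comp t
        ((hasDerivAt_id t).div_const R)
    rw [(h2.fun_mul (differentiable_of_contDiff_top hu t).hasDerivAt).deriv]
    ring
  have habs (t : ℝ) : |t / R| = |t| / R := by rw [abs_div, abs_of_pos hR0]
  have hE := integrable_oscEnergy (p := p) (by linarith) hu hc
  have hsq := integrable_sq hu hc
  have hmass : 1 - oscEnergy p u / R ≤ ∫ t, (χ (t / R) * u t) ^ 2 := by
    have hmono : ∫ t, ((u t) ^ 2 - ((deriv u t) ^ 2 + |t| ^ p * (u t) ^ 2) / R) ≤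
        ∫ t, (χ (t / R) * u t) ^ 2 := by
      refine integral_mono (hsq.sub (hE.div_const R)) (integrable_sq hw hwc) fun t => ?_
      dsimp only
      rcases le_total |t| R with h | h
      · rw [hone _ (by rw [habs]; exact (div_le_one hR0).2 h), one_mul]
        have : 0 ≤ ((deriv u t) ^ 2 + |t| ^ p * (u t) ^ 2) / R := by positivity
        linarith
      · have h2 : R ≤ |t| ^ p :=
          h.trans (Real.self_le_rpow_of_one_le (hR.trans h) hp)
        have h3 : (u t) ^ 2 ≤ ((deriv u t) ^ 2 + |t| ^ p * (u t) ^ 2) / R := by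
          rw [le_div_iff₀ hR0]
          nlinarith [sq_nonneg (deriv u t), mul_le_mul_of_nonneg_right h2 (sq_nonneg (u t))]
        linarith [sq_nonneg (χ (t / R) * u t)]
    rwa [integral_sub hsq (hE.div_const R), integral_div, h1] at hmono
  have henergy : oscEnergy q (fun t => χ (t / R) * u t) ≤
      A * (1 + 1 / R) * oscEnergy p u + 2 * K / R := by
    have hmono : oscEnergy q (fun t => χ (t / R) * u t) ≤
        ∫ t, (A * (1 + 1 / R) * ((deriv u t) ^ 2 + |t| ^ p * (u t) ^ 2) +
          2 * K / R * (u t) ^ 2) := by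
      refine integral_mono (integrable_oscEnergy (by linarith) hw hwc)
        ((hE.const_mul _).add (hsq.const_mul _)) fun t => ?_
      dsimp only
      rw [hwd]
      have hχ2 : χ (t / R) ^ 2 ≤ 1 := pow_le_one₀ (h01 _).1 (h01 _).2
      have hR1 : 0 < 1 / R := by positivity
      have hpot : |t| ^ q * (χ (t / R) * u t) ^ 2 ≤ A * (1 + 1 / R) * (|t| ^ p * (u t) ^ 2) := by
        have hnn : 0 ≤ |t| ^ p * (u t) ^ 2 := by positivity
        rcases le_total |t| (2 * R) with h | h
        · have h2 : |t| ^ q ≤ A * |t| ^ p := by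
            have h3 : |t| ^ q = |t| ^ (q - p) * |t| ^ p := by
              rw [← Real.rpow_add_of_nonneg (abs_nonneg t) (by linarith) (by linarith),
                sub_add_cancel]
            rw [h3]
            exact mul_le_mul_of_nonneg_right
              (Real.rpow_le_rpow (abs_nonneg t) h (by linarith)) (by positivity)
          calc |t| ^ q * (χ (t / R) * u t) ^ 2
              = |t| ^ q * (u t) ^ 2 * χ (t / R) ^ 2 := by ring
            _ ≤ |t| ^ q * (u t) ^ 2 := mul_le_of_le_one_right (by positivity) hχ2
            _ ≤ A * |t| ^ p * (u t) ^ 2 := mul_le_mul_of_nonneg_right h2 (sq_nonneg _)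
            _ = A * (|t| ^ p * (u t) ^ 2) := by ring
            _ ≤ A * (1 + 1 / R) * (|t| ^ p * (u t) ^ 2) :=
              mul_le_mul_of_nonneg_right (by nlinarith) hnn
        · rw [hzero _ (by rw [habs]; exact (le_div_iff₀ hR0).2 h)]
          simp only [zero_mul, ne_eq, OfNat.ofNat_ne_zero, not_false_eq_true, zero_pow, mul_zero]
          positivity
      have hkin : (deriv χ (t / R) / R * u t + χ (t / R) * deriv u t) ^ 2 ≤
          A * (1 + 1 / R) * (deriv u t) ^ 2 + 2 * K / R * (u t) ^ 2 := by
        set a := deriv χ (t / R) * u t with ha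
        set b := χ (t / R) * deriv u t with hb
        have h2 : (a / R + b) ^ 2 ≤ (1 + 1 / R) * b ^ 2 + (1 + R) * (a / R) ^ 2 := by
          have h3 : 0 ≤ (b - R * (a / R)) ^ 2 / R := by positivity
          have h4 : (b - R * (a / R)) ^ 2 / R =
              (1 + 1 / R) * b ^ 2 + (1 + R) * (a / R) ^ 2 - (a / R + b) ^ 2 := by
            field_simp
            ring
          linarith
        have h5 : (1 + 1 / R) * b ^ 2 ≤ A * (1 + 1 / R) * (deriv u t) ^ 2 := by
          have h6 : b ^ 2 ≤ (deriv u t) ^ 2 := by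
            rw [hb, mul_pow]
            exact mul_le_of_le_one_left (sq_nonneg _) hχ2
          exact mul_le_mul (by nlinarith) h6 (sq_nonneg _) (by positivity)
        have h7 : (1 + R) * (a / R) ^ 2 ≤ 2 * K / R * (u t) ^ 2 := by
          have h8 : a ^ 2 ≤ K * (u t) ^ 2 := by
            rw [ha, mul_pow]
            exact mul_le_mul_of_nonneg_right (hK _) (sq_nonneg _)
          have h9 : (1 + R) / R ^ 2 ≤ 2 / R := by
            rw [div_le_div_iff₀ (by positivity) hR0]
            nlinarith
          calc (1 + R) * (a / R) ^ 2 = (1 + R) / R ^ 2 * a ^ 2 := by ring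
            _ ≤ 2 / R * (K * (u t) ^ 2) := mul_le_mul h9 h8 (sq_nonneg _) (by positivity)
            _ = 2 * K / R * (u t) ^ 2 := by ring
        have h10 : deriv χ (t / R) / R * u t = a / R := by rw [ha]; ring
        rw [h10]
        linarith
      linarith
    rwa [integral_add (hE.const_mul _) (hsq.const_mul _), integral_const_mul, integral_const_mul,
      h1, mul_one] at hmono
  exact (mul_le_mul_of_nonneg_left hmass (gammaP_nonneg q)).trans
    ((gammaP_mul_le_oscEnergy q hw hwc).trans henergy)

lemma continuousOn_gammaP : ContinuousOn gammaP (Set.Ici (1 : ℝ)) := by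
  obtain ⟨K, hK0, hK⟩ := exists_gammaP_truncation_bound
  intro p₀ hp₀
  rw [Set.mem_Ici] at hp₀
  set M := gammaP (p₀ + 1) + p₀ with hM
  have hM0 : 0 ≤ M := by linarith [gammaP_nonneg (p₀ + 1)]
  have hbd (p : ℝ) (hp : 1 ≤ p) (hp' : p ≤ p₀ + 1) : gammaP p ≤ M := by
    linarith [gammaP_le_add_sub hp hp']
  have hup (p q R : ℝ) (hp : 1 ≤ p) (hpq : p ≤ q) (hq : q ≤ p₀ + 1) (hR : 1 ≤ R) :
      |gammaP q - gammaP p| ≤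
        (q - p) + (((2 * R) ^ (q - p) * (1 + 1 / R) - 1) * M + (K + M ^ 2) / R) := by
    have hR0 : 0 < R := by linarith
    have h1 := hK p q R hp hpq hR
    have h2 := hbd p hp (by linarith)
    have h3 := hbd q (by linarith) hq
    have hA1 : 1 ≤ (2 * R) ^ (q - p) := Real.one_le_rpow (by linarith) (by linarith)
    have hR1 : 0 < 1 / R := by positivity
    have hA2 : 0 ≤ (2 * R) ^ (q - p) * (1 + 1 / R) - 1 := by nlinarith
    have h4 : gammaP q * gammaP p / R ≤ M ^ 2 / R := by
      rw [sq]
      exact div_le_div_of_nonneg_right (mul_le_mul h3 h2 (gammaP_nonneg p) hM0) hR0.le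
    have h5 := mul_le_mul_of_nonneg_left h2 hA2
    have h6 := gammaP_le_add_sub hp hpq
    have h7 : gammaP q * (1 - gammaP p / R) = gammaP q - gammaP q * gammaP p / R := by ring
    have h8 : (K + M ^ 2) / R = K / R + M ^ 2 / R := add_div _ _ _
    have h9 : 0 ≤ (K + M ^ 2) / R := by positivity
    have h10 : 0 ≤ ((2 * R) ^ (q - p) * (1 + 1 / R) - 1) * M := mul_nonneg hA2 hM0
    rw [abs_le]
    constructor <;> linarith
  rw [ContinuousWithinAt, Metric.tendsto_nhds]
  intro ε hε
  obtain ⟨R, hR1, hRε⟩ : ∃ R : ℝ, 1 ≤ R ∧ (M + (K + M ^ 2)) / R < ε := by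
    have h := (tendsto_const_nhds (x := M + (K + M ^ 2))).div_atTop Filter.tendsto_id
    exact ((Filter.eventually_ge_atTop 1).and (h.eventually (gt_mem_nhds hε))).exists
  have hR0 : 0 < R := by linarith
  have hcont : Continuous fun q : ℝ => |q - p₀| +
      (((2 * R) ^ |q - p₀| * (1 + 1 / R) - 1) * M + (K + M ^ 2) / R) := by
    have h : Continuous fun q : ℝ => (2 * R) ^ |q - p₀| :=
      Continuous.rpow continuous_const (by fun_prop) fun _ => Or.inl (by positivity)
    fun_prop
  have hlt : |p₀ - p₀| +
      (((2 * R) ^ |p₀ - p₀| * (1 + 1 / R) - 1) * M + (K + M ^ 2) / R) < ε := by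
    rw [sub_self, abs_zero, Real.rpow_zero]
    calc _ = (M + (K + M ^ 2)) / R := by ring
      _ < ε := hRε
  filter_upwards [self_mem_nhdsWithin,
    nhdsWithin_le_nhds (hcont.continuousAt.eventually (gt_mem_nhds hlt)),
    nhdsWithin_le_nhds (Iic_mem_nhds (lt_add_one p₀))] with q hq1 hqε hq
  rw [Set.mem_Ici] at hq1
  rw [Set.mem_Iic] at hq
  refine lt_of_le_of_lt ?_ hqε
  rw [Real.dist_eq]
  rcases le_total p₀ q with h | h
  · rw [abs_of_nonneg (sub_nonneg.2 h)]
    exact hup p₀ q R hp₀ h hq hR1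
  · rw [abs_sub_comm, abs_sub_comm q, abs_of_nonneg (sub_nonneg.2 h)]
    exact hup q p₀ R hq1 h (by linarith) hR1

/-- The function `p ↦ γ_p` is continuous on `[1,∞)` and positive there. -/
theorem gammaP_continuousOn_and_pos :
    ContinuousOn gammaP (Set.Ici (1 : ℝ)) ∧ ∀ p : ℝ, 1 ≤ p → 0 < gammaP p := by
  exact ⟨continuousOn_gammaP, fun _ hp => gammaP_pos hp⟩
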